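/- Fix n ≥ 2 and ε > 0. For each s ≥ 1, let q_1, …, q_s be independent Kostlan random homogeneous polynomials of degree 2 in n+1 variables, and let V_s = {i ∈ {1,…,s} : Z(q_i) ≠ ∅}. Then the probability that there exists a subset S ⊆ V_s with |S| ≥ ε·s such that Z(q_i) ∩ Z(q_j) = ∅ for all distinct i, j ∈ S tends to 0 as s → ∞. (Equivalently: the probability that the complement of the intersection graph of the random quadric arrangement contains a clique of size ε·s tends to 0.) -/

import Mathlib

open MeasureTheory ProbabilityTheory

noncomputable section

/-- The index set of monomials of degree `d` in the `n+1` variables `x_0, …, x_n`: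
exponent vectors `α` (each exponent is at most `d`) with `α_0 + ⋯ + α_n = d`. -/
abbrev MonIdx (n d : ℕ) : Type := {α : Fin (n + 1) → Fin (d + 1) // ∑ i, (α i : ℕ) = d}

/-- Evaluation at `x ∈ ℝ^{n+1}` of the homogeneous polynomial of degree `d` with
coefficient vector `c`, namely `Σ_α c_α x_0^{α_0} ⋯ x_n^{α_n}`. -/
def mEval {n d : ℕ} (c : MonIdx n d → ℝ) (x : Fin (n + 1) → ℝ) : ℝ :=
  ∑ α : MonIdx n d, c α * ∏ i, x i ^ (α.1 i : ℕ)

/-- The Kostlan distribution on the space of (coefficient vectors of) homogeneous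
polynomials of degree `d` in `n+1` variables: the coefficients `ξ_α` are independent
centered Gaussians with variance the multinomial coefficient `d!/(α_0! ⋯ α_n!)`. -/
def kostlanMeasure (n d : ℕ) : Measure (MonIdx n d → ℝ) :=
  Measure.pi fun α => gaussianReal 0 (Nat.multinomial Finset.univ fun i => (α.1 i : ℕ))

instance (n d : ℕ) : IsProbabilityMeasure (kostlanMeasure n d) := by
  unfold kostlanMeasure; infer_instance

/-- The quotient topology on a projectivization. -/
instance {K V : Type*} [DivisionRing K] [AddCommGroup V] [Module K V] [TopologicalSpace V] :
    TopologicalSpace (Projectivization K V) :=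
  instTopologicalSpaceQuotient

/-- The zero set in `ℝP^n` of the homogeneous polynomial with coefficients `c`. -/
def zeroSet {n d : ℕ} (c : MonIdx n d → ℝ) : Set (Projectivization ℝ (Fin (n + 1) → ℝ)) :=
  {p | mEval c p.rep = 0}

/-- The number of connected components of a topological space. -/
def b₀ (X : Type*) [TopologicalSpace X] : ℕ := Nat.card (ConnectedComponents X)

/-- A fixed set of small measure contains a linear proportion of a sample with exponentially small
probability. -/
lemma pi_exists_card_le_of_measure_le {X : Type*} [MeasurableSpace X] (μ : Measure X)
    [IsProbabilityMeasure μ] {ε : ℝ} (hε : 0 < ε) {B : Set X}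
    (hB : μ B ≤ (4⁻¹ : ENNReal) ^ (1 / ε)) (s : ℕ) :
    (Measure.pi fun _ : Fin s => μ)
      {ω | ∃ S : Finset (Fin s), ε * (s : ℝ) ≤ (S.card : ℝ) ∧ ∀ i ∈ S, ω i ∈ B} ≤
      (2⁻¹ : ENNReal) ^ s := by
  classical
  have hsub : {ω : Fin s → X | ∃ S : Finset (Fin s), ε * (s : ℝ) ≤ (S.card : ℝ) ∧
      ∀ i ∈ S, ω i ∈ B} ⊆
      ⋃ S ∈ (Finset.univ.filter fun S : Finset (Fin s) => ε * (s : ℝ) ≤ (S.card : ℝ)),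
        Set.univ.pi fun i => if i ∈ S then B else Set.univ := by
    rintro ω ⟨S, hS, h⟩
    simp only [Finset.mem_filter, Finset.mem_univ, true_and, Set.mem_iUnion, Set.mem_pi,
      Set.mem_univ, forall_const]
    refine ⟨S, hS, fun i => ?_⟩
    split_ifs with hi
    exacts [h i hi, Set.mem_univ _]
  have hbound : ∀ S ∈ (Finset.univ.filter fun S : Finset (Fin s) => ε * (s : ℝ) ≤ (S.card : ℝ)),
      (Measure.pi fun _ : Fin s => μ) (Set.univ.pi fun i => if i ∈ S then B else Set.univ) ≤
        (4⁻¹ : ENNReal) ^ s := by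
    intro S hS
    rw [Measure.pi_pi]
    have : ∀ i : Fin s, μ (if i ∈ S then B else Set.univ) = if i ∈ S then μ B else 1 := by
      intro i; split_ifs <;> simp
    simp only [this, Finset.prod_ite_mem, Finset.univ_inter, Finset.prod_const]
    have h4 : (4⁻¹ : ENNReal) ≤ 1 := by simp
    calc μ B ^ S.card ≤ ((4⁻¹ : ENNReal) ^ (1 / ε)) ^ S.card := by gcongr
      _ = (4⁻¹ : ENNReal) ^ (1 / ε * S.card) := by rw [ENNReal.rpow_mul, ENNReal.rpow_natCast]
      _ ≤ (4⁻¹ : ENNReal) ^ (s : ℝ) := by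
        refine ENNReal.rpow_le_rpow_of_exponent_ge h4 ?_
        have hS' := (Finset.mem_filter.1 hS).2
        rw [one_div, ← div_eq_inv_mul, le_div_iff₀ hε]
        linarith
      _ = _ := ENNReal.rpow_natCast _ _
  calc _ ≤ _ := measure_mono hsub
    _ ≤ _ := measure_biUnion_finset_le _ _
    _ ≤ ∑ _S ∈ (Finset.univ.filter fun S : Finset (Fin s) => ε * (s : ℝ) ≤ (S.card : ℝ)),
        (4⁻¹ : ENNReal) ^ s := Finset.sum_le_sum hbound
    _ ≤ ∑ _S : Finset (Fin s), (4⁻¹ : ENNReal) ^ s :=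
        Finset.sum_le_sum_of_subset (Finset.filter_subset _ _)
    _ = (2 * 4⁻¹ : ENNReal) ^ s := by simp [mul_pow]
    _ = _ := by
      congr 1
      rw [show (4 : ENNReal) = 2 * 2 by norm_num, ENNReal.mul_inv (by simp) (by simp), ← mul_assoc,
        ENNReal.mul_inv_cancel (by simp) (by simp), one_mul]

open TopologicalSpace in
/-- The compact sets whose square avoids an open relation form a closed set in the Vietoris
topology. -/
lemma isClosed_compacts_prod_disjoint {X : Type*} [TopologicalSpace X] {G : Set (X × X)}
    (hG : IsOpen G) : IsClosed {L : Compacts X | ∀ x ∈ L, ∀ y ∈ L, (x, y) ∉ G} := by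
  rw [← isOpen_compl_iff, isOpen_iff_mem_nhds]
  intro L hL
  simp only [Set.mem_compl_iff, Set.mem_ofPred_eq, not_forall, not_not] at hL
  obtain ⟨x, hx, y, hy, hxy⟩ := hL
  obtain ⟨U, V, hU, hV, hxU, hyV, hUV⟩ := isOpen_prod_iff.1 hG x y hxy
  filter_upwards [(Compacts.isOpen_inter_nonempty_of_isOpen hU).mem_nhds ⟨x, hx, hxU⟩,
    (Compacts.isOpen_inter_nonempty_of_isOpen hV).mem_nhds ⟨y, hy, hyV⟩]
  rintro L' ⟨x', hx', hxU'⟩ ⟨y', hy', hyV'⟩ h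
  exact h x' hx' y' hy' (hUV ⟨hxU', hyV'⟩)

open Filter Topology TopologicalSpace in
/-- If every compact subset of `C` whose square avoids the open relation `G` is null, then with high
probability an i.i.d. sample has no linear-size subfamily in `C` avoiding `G`. -/
lemma tendsto_measure_linear_clique {X : Type*} [TopologicalSpace X] [T2Space X]
    [MeasurableSpace X] [BorelSpace X] (μ : Measure X) [IsProbabilityMeasure μ]
    [μ.InnerRegularCompactLTTop] [μ.OuterRegular] {C : Set X} (hC : IsClosed C)
    {G : Set (X × X)} (hG : IsOpen G)
    (hnull : ∀ F : Set X, IsCompact F → F ⊆ C → (∀ x ∈ F, ∀ y ∈ F, (x, y) ∉ G) → μ F = 0)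
    {ε : ℝ} (hε : 0 < ε) :
    Tendsto (fun s : ℕ => ((Measure.pi fun _ : Fin s => μ)
      {ω | ∃ S : Finset (Fin s), ε * (s : ℝ) ≤ (S.card : ℝ) ∧ (∀ i ∈ S, ω i ∈ C) ∧
        ∀ i ∈ S, ∀ j ∈ S, (ω i, ω j) ∉ G}).toReal) atTop (𝓝 0) := by
  classical
  set p : ENNReal := (4⁻¹ : ENNReal) ^ (1 / ε)
  have hp0 : 0 < p := ENNReal.rpow_pos (by simp) (by simp)
  have hp2 : p / 2 ≠ 0 := (ENNReal.half_pos hp0.ne').ne'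
  obtain ⟨K, hKC, hK, hμK⟩ :=
    hC.measurableSet.exists_isCompact_sdiff_lt (measure_ne_top μ C) hp2
  have h𝒞 : IsCompact ({L : Compacts X | (L : Set X) ⊆ K} ∩
      {L : Compacts X | ∀ x ∈ L, ∀ y ∈ L, (x, y) ∉ G}) :=
    (Compacts.isCompact_subsets_of_isCompact hK).inter_right (isClosed_compacts_prod_disjoint hG)
  set 𝒞 := {L : Compacts X | (L : Set X) ⊆ K} ∩
      {L : Compacts X | ∀ x ∈ L, ∀ y ∈ L, (x, y) ∉ G}
  have hV : ∀ L : Compacts X, ∃ V : Set X, (L : Set X) ⊆ V ∧ IsOpen V ∧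
      (L ∈ 𝒞 → μ V < p / 2) := by
    intro L
    by_cases hL : L ∈ 𝒞
    · have h0 : μ (L : Set X) = 0 := hnull L L.isCompact (hL.1.trans hKC) hL.2
      obtain ⟨V, h1, h2, h3⟩ := Set.exists_isOpen_lt_of_lt (L : Set X) (p / 2)
        (h0 ▸ pos_iff_ne_zero.2 hp2)
      exact ⟨V, h1, h2, fun _ => h3⟩
    · exact ⟨Set.univ, Set.subset_univ _, isOpen_univ, fun h => absurd h hL⟩
  choose V hLV hVo hVμ using hV
  obtain ⟨t, ht, hcov⟩ := h𝒞.elim_nhds_subcover (fun L => {L' : Compacts X | (L' : Set X) ⊆ V L})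
    (fun L _ => (Compacts.isOpen_subsets_of_isOpen (hVo L)).mem_nhds (hLV L))
  have hle : ∀ s : ℕ, (Measure.pi fun _ : Fin s => μ)
      {ω | ∃ S : Finset (Fin s), ε * (s : ℝ) ≤ (S.card : ℝ) ∧ (∀ i ∈ S, ω i ∈ C) ∧
        ∀ i ∈ S, ∀ j ∈ S, (ω i, ω j) ∉ G} ≤ t.card * (2⁻¹ : ENNReal) ^ s := by
    intro s
    calc _ ≤ (Measure.pi fun _ : Fin s => μ) (⋃ L ∈ t,
          {ω | ∃ S : Finset (Fin s), ε * (s : ℝ) ≤ (S.card : ℝ) ∧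
            ∀ i ∈ S, ω i ∈ (C \ K) ∪ V L}) := by
          refine measure_mono ?_
          rintro ω ⟨S, hS, hSC, hSG⟩
          let L₀ : Compacts X :=
            ⟨ω '' {i | i ∈ S ∧ ω i ∈ K}, ((Set.toFinite _).image ω).isCompact⟩
          have hL₀ : L₀ ∈ 𝒞 := by
            constructor
            · rintro _ ⟨i, hi, rfl⟩
              exact hi.2
            · rintro _ ⟨i, hi, rfl⟩ _ ⟨j, hj, rfl⟩
              exact hSG i hi.1 j hj.1
          obtain ⟨L, hLt, hL⟩ := Set.mem_iUnion₂.1 (hcov hL₀)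
          refine Set.mem_iUnion₂.2 ⟨L, hLt, S, hS, fun i hi => ?_⟩
          by_cases hiK : ω i ∈ K
          · exact Or.inr (hL ⟨i, ⟨hi, hiK⟩, rfl⟩)
          · exact Or.inl ⟨hSC i hi, hiK⟩
      _ ≤ _ := measure_biUnion_finset_le _ _
      _ ≤ ∑ _L ∈ t, (2⁻¹ : ENNReal) ^ s := by
          refine Finset.sum_le_sum fun L hL => pi_exists_card_le_of_measure_le μ hε ?_ s
          calc μ ((C \ K) ∪ V L) ≤ μ (C \ K) + μ (V L) := measure_union_le _ _
            _ ≤ p / 2 + p / 2 := add_le_add hμK.le (hVμ L (ht L hL)).le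
            _ = p := ENNReal.add_halves p
      _ = _ := by simp
  have hlim : Tendsto (fun s : ℕ => (t.card : ENNReal) * (2⁻¹ : ENNReal) ^ s) atTop (𝓝 0) := by
    have := ENNReal.Tendsto.const_mul (a := (t.card : ENNReal))
      (ENNReal.tendsto_pow_atTop_nhds_zero_of_lt_one (r := 2⁻¹) (by simp)) (Or.inr (by simp))
    simpa using this
  have := (ENNReal.tendsto_toReal ENNReal.zero_ne_top).comp
    (tendsto_of_tendsto_of_tendsto_of_le_of_le tendsto_const_nhds hlim (fun _ => zero_le) hle)
  simpa [Function.comp_def] using this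

/-- A finite product of absolutely continuous measures is absolutely continuous. -/
lemma pi_absolutelyContinuous_fin {m : ℕ} {X : Type*} [MeasurableSpace X]
    (μ ν : Fin m → Measure X) [∀ i, SigmaFinite (μ i)] [∀ i, SigmaFinite (ν i)]
    (h : ∀ i, μ i ≪ ν i) : Measure.pi μ ≪ Measure.pi ν := by
  induction m with
  | zero =>
    rw [Measure.pi_of_empty μ, Measure.pi_of_empty ν]
  | succ m ih =>
    have hμ := (measurePreserving_piFinSuccAbove μ 0).symm
    have hν := (measurePreserving_piFinSuccAbove ν 0).symm
    rw [← hμ.map_eq, ← hν.map_eq]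
    exact ((h 0).prod (ih _ _ fun i => h _)).map hμ.measurable

/-- A finite product of absolutely continuous measures is absolutely continuous. -/
lemma pi_absolutelyContinuous {ι : Type*} [Fintype ι] {X : Type*} [MeasurableSpace X]
    (μ ν : ι → Measure X) [∀ i, SigmaFinite (μ i)] [∀ i, SigmaFinite (ν i)]
    (h : ∀ i, μ i ≪ ν i) : Measure.pi μ ≪ Measure.pi ν := by
  let f := (Fintype.equivFin ι).symm
  have hμ := measurePreserving_piCongrLeft μ f
  have hν := measurePreserving_piCongrLeft ν f
  rw [← hμ.map_eq, ← hν.map_eq]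
  exact (pi_absolutelyContinuous_fin _ _ fun i => h (f i)).map hμ.measurable

lemma kostlanMeasure_absolutelyContinuous (n d : ℕ) : kostlanMeasure n d ≪ volume := by
  unfold kostlanMeasure
  rw [volume_pi]
  refine pi_absolutelyContinuous _ _ fun α => gaussianReal_absolutelyContinuous _ ?_
  exact_mod_cast (Nat.multinomial_pos _ _).ne'

lemma exists_prod_pow_eq_mul {n : ℕ} (α : MonIdx n 2) :
    ∃ p : Fin (n + 1) × Fin (n + 1), ∀ x : Fin (n + 1) → ℝ,
      ∏ i, x i ^ (α.1 i : ℕ) = x p.1 * x p.2 := by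
  have hcard : Multiset.card (∑ i, (α.1 i : ℕ) • ({i} : Multiset (Fin (n + 1)))) = 2 := by
    simp [α.2]
  obtain ⟨k, l, hkl⟩ := Multiset.card_eq_two.1 hcard
  refine ⟨(k, l), fun x => ?_⟩
  have := congrArg (fun m => (Multiset.map x m).prod) hkl
  simpa [← Multiset.coe_mapAddMonoidHom, map_sum, Multiset.prod_sum, map_nsmul,
    Multiset.prod_nsmul] using this

/-- A quadratic form written as a sum of products of two coordinates. -/
lemma exists_mEval_eq_sum_mul (n : ℕ) :
    ∃ p : MonIdx n 2 → Fin (n + 1) × Fin (n + 1), ∀ c x,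
      mEval c x = ∑ α, c α * (x (p α).1 * x (p α).2) := by
  choose p hp using exists_prod_pow_eq_mul (n := n)
  exact ⟨p, fun c x => by simp only [mEval, hp]⟩

@[fun_prop]
lemma Continuous.mEval {n d : ℕ} {Y : Type*} [TopologicalSpace Y] {f : Y → MonIdx n d → ℝ}
    {g : Y → Fin (n + 1) → ℝ} (hf : Continuous f) (hg : Continuous g) :
    Continuous fun y => mEval (f y) (g y) := by
  unfold _root_.mEval
  fun_prop

lemma mEval_add_smul_left {n d : ℕ} (c v : MonIdx n d → ℝ) (t : ℝ) (x : Fin (n + 1) → ℝ) :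
    mEval (c + t • v) x = mEval c x + t * mEval v x := by
  simp only [mEval, Pi.add_apply, Pi.smul_apply, smul_eq_mul, add_mul, Finset.sum_add_distrib,
    Finset.mul_sum, mul_assoc]

lemma mEval_smul {n : ℕ} (c : MonIdx n 2 → ℝ) (t : ℝ) (x : Fin (n + 1) → ℝ) :
    mEval c (t • x) = t ^ 2 * mEval c x := by
  obtain ⟨p, hp⟩ := exists_mEval_eq_sum_mul n
  rw [hp, hp, Finset.mul_sum]
  exact Finset.sum_congr rfl fun α _ => by simp; ring

/-- The polar bilinear form of a quadratic form. -/
def quadPolar {n : ℕ} (c : MonIdx n 2 → ℝ) (x y : Fin (n + 1) → ℝ) : ℝ :=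
  mEval c (x + y) - mEval c x - mEval c y

lemma mEval_add_smul {n : ℕ} (c : MonIdx n 2 → ℝ) (x y : Fin (n + 1) → ℝ) (r : ℝ) :
    mEval c (x + r • y) = mEval c y * r ^ 2 + quadPolar c x y * r + mEval c x := by
  obtain ⟨p, hp⟩ := exists_mEval_eq_sum_mul n
  simp only [quadPolar, hp, Finset.sum_mul, ← Finset.sum_sub_distrib, ← Finset.sum_add_distrib]
  exact Finset.sum_congr rfl fun α _ => by simp; ring

/-- Every product of two linear forms is a quadratic form. -/
lemma exists_mEval_eq_mul {n : ℕ} (L M : (Fin (n + 1) → ℝ) →ₗ[ℝ] ℝ) :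
    ∃ v : MonIdx n 2 → ℝ, ∀ x, mEval v x = L x * M x := by
  classical
  have hmon : ∀ i j : Fin (n + 1), ∃ v : MonIdx n 2 → ℝ, ∀ x, mEval v x = x i * x j := by
    intro i j
    have hlt : ∀ k, (Pi.single i 1 + Pi.single j 1 : Fin (n + 1) → ℕ) k < 2 + 1 := by
      intro k
      simp only [Pi.add_apply, Pi.single_apply]
      split_ifs <;> norm_num
    let α : MonIdx n 2 := ⟨fun k => ⟨_, hlt k⟩, by simp [Finset.sum_add_distrib]⟩
    refine ⟨Pi.single α 1, fun x => ?_⟩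
    have h1 : mEval (Pi.single α 1) x = ∏ k, x k ^ (α.1 k : ℕ) := by
      simp [mEval, Pi.single_apply]
    rw [h1]
    simp only [α, Pi.add_apply, pow_add, Finset.prod_mul_distrib, Pi.single_apply, pow_ite,
      pow_one, pow_zero]
    simp
  choose v hv using hmon
  refine ⟨∑ i, ∑ j, (L (Pi.single i 1) * M (Pi.single j 1)) • v i j, fun x => ?_⟩
  have hL : ∀ N : (Fin (n + 1) → ℝ) →ₗ[ℝ] ℝ, N x = ∑ i, x i * N (Pi.single i 1) := by
    intro N
    conv_lhs => rw [← Finset.univ_sum_single x, map_sum]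
    refine Finset.sum_congr rfl fun i _ => ?_
    rw [← smul_eq_mul, ← map_smul, ← Pi.single_smul, smul_eq_mul, mul_one]
  have hlin : ∀ (s : Finset (Fin (n + 1))) (f : Fin (n + 1) → MonIdx n 2 → ℝ),
      mEval (∑ i ∈ s, f i) x = ∑ i ∈ s, mEval (f i) x := by
    intro s f
    simp only [mEval, Finset.sum_apply, Finset.sum_mul]
    exact Finset.sum_comm
  have hsm : ∀ (t : ℝ) (f : MonIdx n 2 → ℝ), mEval (t • f) x = t * mEval f x := by
    intro t f
    simp [mEval, Finset.mul_sum, mul_assoc]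
  simp only [hlin, hsm, hv, hL L, hL M, Finset.sum_mul_sum]
  exact Finset.sum_congr rfl fun i _ => Finset.sum_congr rfl fun j _ => by ring

/-- The larger root of `A r ^ 2 + B r + C`. -/
def posRoot (A B C : ℝ) : ℝ := (-B + √(B ^ 2 - 4 * A * C)) / (2 * A)

lemma exists_quadratic_eq_mul_posRoot {A B C : ℝ} (hA : 0 < A) (hC : C < 0) :
    0 < posRoot A B C ∧ ∃ r' < 0, ∀ r,
      A * r ^ 2 + B * r + C = A * ((r - posRoot A B C) * (r - r')) := by
  have hAC : 0 < -(4 * A * C) := by nlinarith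
  have hD : 0 ≤ B ^ 2 - 4 * A * C := by nlinarith [sq_nonneg B]
  have hs : |B| < √(B ^ 2 - 4 * A * C) := by
    rw [← Real.sqrt_sq_eq_abs]
    exact Real.sqrt_lt_sqrt (sq_nonneg _) (by linarith)
  have hs2 := Real.sq_sqrt hD
  obtain ⟨h1, h2⟩ := abs_lt.1 hs
  refine ⟨div_pos (by linarith) (by linarith),
    (-B - √(B ^ 2 - 4 * A * C)) / (2 * A), div_neg_of_neg_of_pos (by linarith) (by linarith),
    fun r => ?_⟩
  unfold posRoot
  generalize √(B ^ 2 - 4 * A * C) = S at hs2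
  field_simp
  linear_combination hs2

lemma quadratic_posRoot {A B C : ℝ} (hA : 0 < A) (hC : C < 0) :
    A * posRoot A B C ^ 2 + B * posRoot A B C + C = 0 := by
  obtain ⟨-, r', -, h⟩ := exists_quadratic_eq_mul_posRoot (B := B) hA hC
  simp [h]

lemma posRoot_lt_of_quadratic_pos {A B C r : ℝ} (hA : 0 < A) (hC : C < 0) (hr : 0 < r)
    (h : 0 < A * r ^ 2 + B * r + C) : posRoot A B C < r := by
  obtain ⟨-, r', hr', h'⟩ := exists_quadratic_eq_mul_posRoot (B := B) hA hC
  rw [h'] at h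
  have := (pos_iff_pos_of_mul_pos (pos_of_mul_pos_right h hA.le)).2 (by linarith)
  linarith

lemma lt_posRoot_of_quadratic_neg {A B C r : ℝ} (hA : 0 < A) (hC : C < 0) (hr : 0 < r)
    (h : A * r ^ 2 + B * r + C < 0) : r < posRoot A B C := by
  obtain ⟨-, r', hr', h'⟩ := exists_quadratic_eq_mul_posRoot (B := B) hA hC
  rw [h'] at h
  by_contra! hle
  have := mul_nonneg hA.le (mul_nonneg (sub_nonneg.2 hle) (by linarith : 0 ≤ r - r'))
  linarith

/-- Quadratic forms that are negative at `b` and, for a manifest reason, positive on the segment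
`a + [-1, 1] e`. -/
def segmentCell {n : ℕ} (a b e : Fin (n + 1) → ℝ) : Set (MonIdx n 2 → ℝ) :=
  {c | mEval c b < 0 ∧ |quadPolar c a e| + |mEval c e| < mEval c a}

lemma isOpen_segmentCell {n : ℕ} (a b e : Fin (n + 1) → ℝ) : IsOpen (segmentCell a b e) := by
  unfold segmentCell quadPolar
  rw [Set.ofPred_and]
  exact IsOpen.inter (isOpen_lt (by fun_prop) (by fun_prop))
    (isOpen_lt (by fun_prop) (by fun_prop))

lemma mEval_segment_pos {n : ℕ} {a b e : Fin (n + 1) → ℝ} {c : MonIdx n 2 → ℝ}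
    (hc : c ∈ segmentCell a b e) {θ : ℝ} (hθ : θ ∈ Set.Icc (-1 : ℝ) 1) :
    0 < mEval c (a + θ • e) := by
  rw [mEval_add_smul]
  have hθ' : |θ| ≤ 1 := abs_le.2 hθ
  have h1 : |quadPolar c a e * θ| ≤ |quadPolar c a e| := by
    rw [abs_mul]; exact mul_le_of_le_one_right (abs_nonneg _) hθ'
  have h2 : |mEval c e * θ ^ 2| ≤ |mEval c e| := by
    rw [abs_mul, abs_pow]
    exact mul_le_of_le_one_right (abs_nonneg _) (pow_le_one₀ (abs_nonneg _) hθ')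
  have := hc.2
  linarith [(abs_le.1 h1).1, (abs_le.1 h2).1]

/-- The positive parameter at which the ray from `b` in direction `a + θ e` meets the quadric. -/
def rayRoot {n : ℕ} (a b e : Fin (n + 1) → ℝ) (c : MonIdx n 2 → ℝ) (θ : ℝ) : ℝ :=
  posRoot (mEval c (a + θ • e)) (quadPolar c b (a + θ • e)) (mEval c b)

lemma continuousOn_rayRoot {n : ℕ} (a b e : Fin (n + 1) → ℝ) :
    ContinuousOn (fun p : (MonIdx n 2 → ℝ) × ℝ => rayRoot a b e p.1 p.2)
      (segmentCell a b e ×ˢ Set.Icc (-1) 1) := by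
  unfold rayRoot posRoot quadPolar
  refine ContinuousOn.div (by fun_prop) (by fun_prop) ?_
  rintro ⟨c, θ⟩ ⟨hc, hθ⟩
  exact mul_ne_zero two_ne_zero (mEval_segment_pos hc hθ).ne'

lemma mEval_rayRoot {n : ℕ} {a b e : Fin (n + 1) → ℝ} {c : MonIdx n 2 → ℝ}
    (hc : c ∈ segmentCell a b e) {θ : ℝ} (hθ : θ ∈ Set.Icc (-1 : ℝ) 1) :
    mEval c (b + rayRoot a b e c θ • (a + θ • e)) = 0 := by
  rw [mEval_add_smul]
  exact quadratic_posRoot (mEval_segment_pos hc hθ) hc.1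

lemma rayRoot_pos {n : ℕ} {a b e : Fin (n + 1) → ℝ} {c : MonIdx n 2 → ℝ}
    (hc : c ∈ segmentCell a b e) {θ : ℝ} (hθ : θ ∈ Set.Icc (-1 : ℝ) 1) :
    0 < rayRoot a b e c θ :=
  (exists_quadratic_eq_mul_posRoot (mEval_segment_pos hc hθ) hc.1).1

/-- The pairs of quadratic forms with a common nontrivial zero. -/
def commonZero (n : ℕ) : Set ((MonIdx n 2 → ℝ) × (MonIdx n 2 → ℝ)) :=
  {p | ∃ x ≠ 0, mEval p.1 x = 0 ∧ mEval p.2 x = 0}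

lemma mem_commonZero_of_rayRoot_lt {n : ℕ} {a b e : Fin (n + 1) → ℝ} {c c' : MonIdx n 2 → ℝ}
    (hc : c ∈ segmentCell a b e) (hc' : c' ∈ segmentCell a b e)
    (h₀ : rayRoot a b e c' (-1) < rayRoot a b e c (-1))
    (h₁ : rayRoot a b e c 1 < rayRoot a b e c' 1) : (c, c') ∈ commonZero n := by
  have hcont : ∀ d ∈ segmentCell a b e,
      ContinuousOn (rayRoot a b e d) (Set.Icc (-1) 1) := fun d hd =>
    (continuousOn_rayRoot a b e).comp (f := fun θ : ℝ => (d, θ)) (by fun_prop)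
      fun θ hθ => ⟨hd, hθ⟩
  obtain ⟨θ, hθ, h⟩ := intermediate_value_Icc (by norm_num : (-1 : ℝ) ≤ 1)
    ((hcont c' hc').sub (hcont c hc)) (show (0 : ℝ) ∈ _ from ⟨by simp; linarith, by simp; linarith⟩)
  have h : rayRoot a b e c' θ = rayRoot a b e c θ := sub_eq_zero.1 h
  refine ⟨b + rayRoot a b e c θ • (a + θ • e), fun h0 => ?_, mEval_rayRoot hc hθ,
    h ▸ mEval_rayRoot hc' hθ⟩
  have hb : b = (-rayRoot a b e c θ) • (a + θ • e) := by
    rw [neg_smul]; exact eq_neg_of_add_eq_zero_left h0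
  have := hc.1
  rw [hb, mEval_smul] at this
  nlinarith [mEval_segment_pos hc hθ, sq_nonneg (-rayRoot a b e c θ)]

lemma mem_interior_commonZero {n : ℕ} {a b e : Fin (n + 1) → ℝ} {c c' : MonIdx n 2 → ℝ}
    (hc : c ∈ segmentCell a b e) (hc' : c' ∈ segmentCell a b e)
    (h₀ : rayRoot a b e c' (-1) < rayRoot a b e c (-1))
    (h₁ : rayRoot a b e c 1 < rayRoot a b e c' 1) : (c, c') ∈ interior (commonZero n) := by
  have hcont : ∀ θ ∈ Set.Icc (-1 : ℝ) 1, ∀ d ∈ segmentCell a b e,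
      ContinuousAt (fun d => rayRoot a b e d θ) d := fun θ hθ d hd =>
    ((continuousOn_rayRoot a b e).comp (f := fun d => (d, θ)) (s := segmentCell a b e)
      (by fun_prop) fun d hd => ⟨hd, hθ⟩).continuousAt ((isOpen_segmentCell a b e).mem_nhds hd)
  have hfst : ∀ θ ∈ Set.Icc (-1 : ℝ) 1, ContinuousAt
      (fun p : (MonIdx n 2 → ℝ) × (MonIdx n 2 → ℝ) => rayRoot a b e p.1 θ) (c, c') :=
    fun θ hθ => ContinuousAt.comp (g := fun d => rayRoot a b e d θ) (f := Prod.fst) (x := (c, c'))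
      (hcont θ hθ c hc) continuousAt_fst
  have hsnd : ∀ θ ∈ Set.Icc (-1 : ℝ) 1, ContinuousAt
      (fun p : (MonIdx n 2 → ℝ) × (MonIdx n 2 → ℝ) => rayRoot a b e p.2 θ) (c, c') :=
    fun θ hθ => ContinuousAt.comp (g := fun d => rayRoot a b e d θ) (f := Prod.snd) (x := (c, c'))
      (hcont θ hθ c' hc') continuousAt_snd
  rw [mem_interior_iff_mem_nhds]
  filter_upwards [(hsnd _ (by simp)).eventually_lt (hfst _ (by simp)) h₀,
    (hfst _ (by simp)).eventually_lt (hsnd _ (by simp)) h₁,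
    prod_mem_nhds ((isOpen_segmentCell a b e).mem_nhds hc)
      ((isOpen_segmentCell a b e).mem_nhds hc')] with p h₀ h₁ hp
  exact mem_commonZero_of_rayRoot_lt hp.1 hp.2 h₀ h₁

open Filter Topology in
/-- Around an indefinite form there is a cell and a direction in which the ray roots at the two
ends of the segment move oppositely. -/
lemma exists_segmentCell {n : ℕ} (hn : 2 ≤ n) {c : MonIdx n 2 → ℝ} {a b : Fin (n + 1) → ℝ}
    (ha : 0 < mEval c a) (hb : mEval c b < 0) :
    ∃ (e : Fin (n + 1) → ℝ) (v : MonIdx n 2 → ℝ), c ∈ segmentCell a b e ∧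
      (∀ r > (0 : ℝ), 0 < mEval v (b + r • (a + (-1 : ℝ) • e))) ∧
      ∀ r > (0 : ℝ), mEval v (b + r • (a + (1 : ℝ) • e)) < 0 := by
  classical
  have hspan : Submodule.span ℝ
      (({a, b} : Finset (Fin (n + 1) → ℝ)) : Set (Fin (n + 1) → ℝ)) < ⊤ := by
    refine Submodule.lt_top_of_finrank_lt_finrank ?_
    calc _ ≤ ({a, b} : Finset (Fin (n + 1) → ℝ)).card := finrank_span_finset_le_card _
      _ ≤ 2 := Finset.card_le_two
      _ < _ := by simp; omega
  obtain ⟨L, hL0, hL⟩ := Submodule.exists_le_ker_of_lt_top _ hspan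
  have hLa : L a = 0 := hL (Submodule.subset_span (by simp))
  have hLb : L b = 0 := hL (Submodule.subset_span (by simp))
  obtain ⟨e₀, he₀⟩ : ∃ e₀, 0 < L e₀ := by
    obtain ⟨x, hx⟩ := DFunLike.ne_iff.1 hL0
    rcases lt_or_gt_of_ne hx with h | h
    · exact ⟨-x, by simpa using h⟩
    · exact ⟨x, h⟩
  have hab : a ∉ Submodule.span ℝ {b} := by
    rw [Submodule.mem_span_singleton]
    rintro ⟨t, rfl⟩
    rw [mEval_smul] at ha
    nlinarith [sq_nonneg t]
  obtain ⟨K, hKa, hK⟩ := Submodule.exists_le_ker_of_notMem hab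
  have hKb : K b = 0 := hK (Submodule.mem_span_singleton_self b)
  obtain ⟨v, hv⟩ := exists_mEval_eq_mul L (-(K a)⁻¹ • K)
  have hz : mEval c (0 : Fin (n + 1) → ℝ) = 0 := by
    simpa using mEval_smul c 0 (0 : Fin (n + 1) → ℝ)
  have h1 : ∀ᶠ η : ℝ in 𝓝 0,
      |quadPolar c a (η • e₀)| + |mEval c (η • e₀)| < mEval c a := by
    have : Continuous fun η : ℝ => |quadPolar c a (η • e₀)| + |mEval c (η • e₀)| := by
      unfold quadPolar; fun_prop
    refine this.continuousAt.eventually_lt continuousAt_const ?_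
    simpa [quadPolar, hz] using ha
  have h2 : ∀ᶠ η : ℝ in 𝓝 0, |η * ((K a)⁻¹ * K e₀)| < 1 := by
    have : Continuous fun η : ℝ => |η * ((K a)⁻¹ * K e₀)| := by fun_prop
    refine this.continuousAt.eventually_lt continuousAt_const ?_
    simp
  obtain ⟨η, ⟨hη1, hη2⟩, hη : 0 < η⟩ :=
    (((h1.and h2).filter_mono nhdsWithin_le_nhds).and (self_mem_nhdsWithin (s := Set.Ioi 0))).exists
  have hval : ∀ θ r : ℝ, mEval v (b + r • (a + θ • η • e₀)) =
      -(θ * (r ^ 2 * (η * L e₀) * (1 + θ * (η * ((K a)⁻¹ * K e₀))))) := by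
    intro θ r
    rw [hv]
    simp only [map_add, map_smul, hLa, hLb, hKb, LinearMap.smul_apply, smul_eq_mul]
    field_simp
    ring
  obtain ⟨h3, h4⟩ := abs_lt.1 hη2
  refine ⟨η • e₀, v, ⟨hb, hη1⟩, fun r hr => ?_, fun r hr => ?_⟩
  · rw [hval]
    have : 0 < r ^ 2 * (η * L e₀) * (1 + -1 * (η * ((K a)⁻¹ * K e₀))) :=
      mul_pos (by positivity) (by linarith)
    linarith
  · rw [hval]
    have : 0 < r ^ 2 * (η * L e₀) * (1 + 1 * (η * ((K a)⁻¹ * K e₀))) :=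
      mul_pos (by positivity) (by linarith)
    linarith

open Filter Topology in
/-- A closed family of quadratic forms with no robustly intersecting pair has a null indefinite
part. -/
lemma volume_inter_indefinite_eq_zero {n : ℕ} (hn : 2 ≤ n) {F : Set (MonIdx n 2 → ℝ)}
    (hF : IsClosed F)
    (hFG : ∀ x ∈ F, ∀ y ∈ F, x ≠ y → (x, y) ∉ interior (commonZero n)) :
    volume (F ∩ {c | (∃ a, 0 < mEval c a) ∧ ∃ b, mEval c b < 0}) = 0 := by
  refine measure_null_of_locally_null _ ?_
  rintro c ⟨hcF, ⟨a, ha⟩, b, hb⟩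
  obtain ⟨e, v, hc, hv₀, hv₁⟩ := exists_segmentCell hn ha hb
  refine ⟨F ∩ segmentCell a b e, Filter.inter_mem
    (mem_of_superset self_mem_nhdsWithin Set.inter_subset_left)
    (mem_nhdsWithin_of_mem_nhds ((isOpen_segmentCell a b e).mem_nhds hc)), ?_⟩
  by_contra hpos
  have hst := Measure.sub_mem_nhds_zero_of_addHaar_pos volume (F ∩ segmentCell a b e)
    (hF.measurableSet.inter (isOpen_segmentCell a b e).measurableSet) (pos_iff_ne_zero.2 hpos)
  have hcont : Tendsto (fun t : ℝ => t • v) (𝓝 0) (𝓝 0) := by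
    have : Continuous fun t : ℝ => t • v := by fun_prop
    simpa using this.tendsto 0
  obtain ⟨t, ht, ht0 : 0 < t⟩ := (((hcont.eventually_mem hst).filter_mono
    nhdsWithin_le_nhds).and (self_mem_nhdsWithin (s := Set.Ioi 0))).exists
  obtain ⟨x, hx, y, hy, hxy⟩ := Set.mem_sub.1 ht
  have hxy : x = y + t • v := sub_eq_iff_eq_add'.1 hxy
  have hm₀ : (-1 : ℝ) ∈ Set.Icc (-1 : ℝ) 1 := by simp
  have hm₁ : (1 : ℝ) ∈ Set.Icc (-1 : ℝ) 1 := by simp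
  have h₀ : rayRoot a b e x (-1) < rayRoot a b e y (-1) := by
    have hr := rayRoot_pos hy.2 hm₀
    refine posRoot_lt_of_quadratic_pos (mEval_segment_pos hx.2 hm₀) hx.2.1 hr ?_
    rw [← mEval_add_smul, hxy, mEval_add_smul_left, mEval_rayRoot hy.2 hm₀, zero_add]
    exact mul_pos ht0 (hv₀ _ hr)
  have h₁ : rayRoot a b e y 1 < rayRoot a b e x 1 := by
    have hr := rayRoot_pos hy.2 hm₁
    refine lt_posRoot_of_quadratic_neg (mEval_segment_pos hx.2 hm₁) hx.2.1 hr ?_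
    rw [← mEval_add_smul, hxy, mEval_add_smul_left, mEval_rayRoot hy.2 hm₁, zero_add]
    exact mul_neg_of_pos_of_neg ht0 (hv₁ _ hr)
  exact hFG y hy.1 x hx.1 (fun h => h₀.ne (by rw [h]))
    (mem_interior_commonZero hy.2 hx.2 h₀ h₁)

lemma convex_nonneg_forms (n : ℕ) : Convex ℝ {c : MonIdx n 2 → ℝ | ∀ x, 0 ≤ mEval c x} := by
  intro c hc d hd s t hs ht _ x
  have h := mEval_add_smul_left (s • c) d t x
  have h' := mEval_add_smul_left 0 c s x
  rw [zero_add] at h'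
  rw [h, h']
  have h0 : mEval (0 : MonIdx n 2 → ℝ) x = 0 := by simp [mEval]
  have := mul_nonneg hs (hc x)
  have := mul_nonneg ht (hd x)
  linarith

lemma mEval_neg {n d : ℕ} (c : MonIdx n d → ℝ) (x : Fin (n + 1) → ℝ) :
    mEval (-c) x = -mEval c x := by
  simp [mEval]

/-- The forms that are semidefinite, and remain so under small perturbations. -/
def stablySemidefinite (n : ℕ) : Set (MonIdx n 2 → ℝ) :=
  interior {c | ∀ x, 0 ≤ mEval c x} ∪ interior {c | ∀ x, 0 ≤ mEval (-c) x}

open Filter Topology in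
lemma eq_zero_of_mem_interior_nonneg {n : ℕ} {c : MonIdx n 2 → ℝ}
    (hc : c ∈ interior {c : MonIdx n 2 → ℝ | ∀ x, 0 ≤ mEval c x}) {x : Fin (n + 1) → ℝ}
    (hx : mEval c x = 0) : x = 0 := by
  by_contra hx0
  obtain ⟨i, hi⟩ := Function.ne_iff.1 hx0
  obtain ⟨v, hv⟩ := exists_mEval_eq_mul (LinearMap.proj i : (Fin (n + 1) → ℝ) →ₗ[ℝ] ℝ)
    (-LinearMap.proj i)
  have hcont : Tendsto (fun t : ℝ => c + t • v) (𝓝 0) (𝓝 c) := by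
    have : Continuous fun t : ℝ => c + t • v := by fun_prop
    simpa using this.tendsto 0
  obtain ⟨t, ht, ht0 : 0 < t⟩ := (((hcont.eventually_mem
    (mem_interior_iff_mem_nhds.1 hc)).filter_mono nhdsWithin_le_nhds).and
      (self_mem_nhdsWithin (s := Set.Ioi 0))).exists
  have h := ht x
  rw [mEval_add_smul_left, hx, hv] at h
  simp only [LinearMap.proj_apply, LinearMap.neg_apply, zero_add] at h
  have : 0 < x i * x i := mul_self_pos.2 hi
  nlinarith

lemma eq_zero_of_mem_stablySemidefinite {n : ℕ} {c : MonIdx n 2 → ℝ}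
    (hc : c ∈ stablySemidefinite n) {x : Fin (n + 1) → ℝ} (hx : mEval c x = 0) : x = 0 := by
  rcases hc with hc | hc
  · exact eq_zero_of_mem_interior_nonneg hc hx
  · refine eq_zero_of_mem_interior_nonneg (c := -c) ?_ (by rw [mEval_neg, hx, neg_zero])
    rw [mem_interior_iff_mem_nhds] at hc ⊢
    have := (continuous_neg (G := MonIdx n 2 → ℝ)).continuousAt (x := -c)
    have := this.preimage_mem_nhds (by rwa [neg_neg])
    simpa using this

lemma volume_eq_zero_of_forall_notMem_interior_commonZero {n : ℕ} (hn : 2 ≤ n)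
    {F : Set (MonIdx n 2 → ℝ)} (hF : IsClosed F) (hFC : F ⊆ (stablySemidefinite n)ᶜ)
    (hFG : ∀ x ∈ F, ∀ y ∈ F, x ≠ y → (x, y) ∉ interior (commonZero n)) : volume F = 0 := by
  have hN : Convex ℝ {c : MonIdx n 2 → ℝ | ∀ x, 0 ≤ mEval (-c) x} :=
    (convex_nonneg_forms n).neg
  refine measure_mono_null (t := (F ∩ {c | (∃ a, 0 < mEval c a) ∧ ∃ b, mEval c b < 0}) ∪
    (frontier {c : MonIdx n 2 → ℝ | ∀ x, 0 ≤ mEval c x} ∪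
      frontier {c : MonIdx n 2 → ℝ | ∀ x, 0 ≤ mEval (-c) x})) ?_
    (measure_union_null (volume_inter_indefinite_eq_zero hn hF hFG)
      (measure_union_null ((convex_nonneg_forms n).addHaar_frontier _) (hN.addHaar_frontier _)))
  intro c hc
  have hcC := hFC hc
  simp only [stablySemidefinite, Set.mem_compl_iff, Set.mem_union, not_or] at hcC
  by_cases hp : ∀ x, 0 ≤ mEval c x
  · exact Or.inr (Or.inl ⟨subset_closure hp, hcC.1⟩)
  by_cases hm : ∀ x, 0 ≤ mEval (-c) x
  · exact Or.inr (Or.inr ⟨subset_closure hm, hcC.2⟩)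
  · push Not at hp hm
    obtain ⟨a, ha⟩ := hm
    exact Or.inl ⟨hc, ⟨a, by rw [mEval_neg] at ha; linarith⟩, hp⟩

lemma inter_zeroSet_nonempty_of_mem_commonZero {n : ℕ} {c c' : MonIdx n 2 → ℝ}
    (h : (c, c') ∈ commonZero n) : (zeroSet c ∩ zeroSet c').Nonempty := by
  obtain ⟨x, hx0, hx, hx'⟩ := h
  obtain ⟨t, ht⟩ := Projectivization.exists_smul_eq_mk_rep ℝ x hx0
  refine ⟨Projectivization.mk ℝ x hx0, ?_, ?_⟩
  · change mEval c _ = 0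
    rw [← ht, Units.smul_def, mEval_smul, show mEval c x = 0 from hx, mul_zero]
  · change mEval c' _ = 0
    rw [← ht, Units.smul_def, mEval_smul, show mEval c' x = 0 from hx', mul_zero]

/-- Fix `n ≥ 2` and `ε > 0`. For each `s ≥ 1`, let `q_1, …, q_s` be independent Kostlan
random homogeneous polynomials of degree `2` in `n+1` variables. Then the probability
that there exists a set `S` of at least `ε⬝s` indices, all of whose quadrics have nonempty
projective zero sets which are pairwise disjoint (i.e. a clique of size `ε⬝s` in the
complement of the intersection graph of the arrangement), tends to `0` as `s → ∞`. -/
theorem no_linear_clique_in_complement (n : ℕ) (hn : 2 ≤ n) (ε : ℝ) (hε : 0 < ε) :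
    Filter.Tendsto
      (fun s : ℕ =>
        ((Measure.pi fun _ : Fin s => kostlanMeasure n 2)
          {ω | ∃ S : Finset (Fin s), ε * (s : ℝ) ≤ (S.card : ℝ) ∧
                (∀ i ∈ S, (zeroSet (ω i)).Nonempty) ∧
                (∀ i ∈ S, ∀ j ∈ S, i ≠ j → zeroSet (ω i) ∩ zeroSet (ω j) = ∅)}).toReal)
      Filter.atTop (nhds 0) := by
  have hG : IsOpen (interior (commonZero n) ∩
      {p : (MonIdx n 2 → ℝ) × (MonIdx n 2 → ℝ) | p.1 ≠ p.2}) :=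
    isOpen_interior.inter (isOpen_ne_fun continuous_fst continuous_snd)
  have hC : IsClosed (stablySemidefinite n)ᶜ :=
    (isOpen_interior.union isOpen_interior).isClosed_compl
  have key := tendsto_measure_linear_clique (kostlanMeasure n 2) hC hG
    (fun F hF hFC hFG => kostlanMeasure_absolutelyContinuous n 2
      (volume_eq_zero_of_forall_notMem_interior_commonZero hn hF.isClosed hFC
        fun x hx y hy hxy h => hFG x hx y hy ⟨h, hxy⟩)) hε
  refine tendsto_of_tendsto_of_tendsto_of_le_of_le tendsto_const_nhds key
    (fun _ => ENNReal.toReal_nonneg) fun s => ?_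
  refine ENNReal.toReal_mono (measure_ne_top _ _) (measure_mono ?_)
  rintro ω ⟨S, hS, hne, hdisj⟩
  refine ⟨S, hS, fun i hi hmem => ?_, fun i hi j hj hij => ?_⟩
  · obtain ⟨p, hp⟩ := hne i hi
    exact p.rep_nonzero (eq_zero_of_mem_stablySemidefinite hmem hp)
  · have hij' : i ≠ j := fun h => hij.2 (by rw [h])
    exact (inter_zeroSet_nonempty_of_mem_commonZero (interior_subset hij.1)).ne_empty
      (hdisj i hi j hj hij')
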